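/- Suppose χ is a primitive Dirichlet character modulo N_β, let g = gcd(N_β, N_β(γ,β)), and let p be a prime dividing g such that N_β = p^{v} where v = ν_p(N_β). Then for every integer α ≥ ν_p(g): G_{γ,n}(p^α; β, χ) = χ(−1) · G(χ) · p^{α−v} · ∑_{u mod p^v, gcd(u,p)=1, u·p^α ≡ N_β(γ,β) (mod p^v)} χ̄(u) · ∑_{ν mod p^v} ( N_{γ−νβ, n + p^{α}νu/p^{v}}(p^α) − p^{m−1} · N_{γ−νβ, n + p^{α}νu/p^{v}}(p^{α−1}) ). (Here for every u appearing in the sum, one has (n + p^{α}νu/p^{v}) + Q(γ − νβ) ∈ ℤ, so the representation numbers are defined; χ̄ is the complex conjugate character.) -/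

import Mathlib

open Finset Matrix

namespace EisensteinWeil

variable {m : ℕ}

/-- The bilinear form `(x,y) = xᵀ S y` on `ℚ^m`. -/
def bil (S : Matrix (Fin m) (Fin m) ℤ) (x y : Fin m → ℚ) : ℚ :=
  x ⬝ᵥ (S.map (Int.cast : ℤ → ℚ)).mulVec y

/-- The quadratic form `Q(x) = (x,x)/2`. -/
def Qf (S : Matrix (Fin m) (Fin m) ℤ) (x : Fin m → ℚ) : ℚ := bil S x x / 2

/-- Membership in the dual lattice `L' = S⁻¹ℤ^m`: `x ∈ L'` iff `(x,r) ∈ ℤ` for all `r ∈ ℤ^m`. -/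
def memDual (S : Matrix (Fin m) (Fin m) ℤ) (γ : Fin m → ℚ) : Prop :=
  ∀ r : Fin m → ℤ, ∃ z : ℤ, bil S γ (fun i => (r i : ℚ)) = z

/-- `N` is the order of `γ + ℤ^m` in `L'/ℤ^m`, i.e. the smallest positive integer with
`N • γ ∈ ℤ^m`. -/
def isOrderOf (γ : Fin m → ℚ) (N : ℕ) : Prop :=
  0 < N ∧ (∀ i, ∃ z : ℤ, (N : ℚ) * γ i = z) ∧
    ∀ k : ℕ, 0 < k → (∀ i, ∃ z : ℤ, (k : ℚ) * γ i = z) → N ≤ k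

/-- The representation number `N_{γ,n}(a)`, counting `r ∈ (ℤ^m)/(aℤ^m)`
(represented by `r : Fin m → Fin a`) with `Q(r − γ) + n ≡ 0 (mod a)`. -/
noncomputable def repNum (S : Matrix (Fin m) (Fin m) ℤ) (γ : Fin m → ℚ) (n : ℚ) (a : ℕ) : ℕ :=
  Nat.card {r : Fin m → Fin a //
    ∃ t : ℤ, Qf S ((fun i => ((r i : ℕ) : ℚ)) - γ) + n = (a : ℚ) * t}

/-- `e(x) = e^{2πix}`. -/
noncomputable def eQ (x : ℚ) : ℂ := Complex.exp (2 * Real.pi * Complex.I * (x : ℂ))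

/-- A canonical choice of inverse of `d` modulo `c`. -/
def adInv (c d : ℕ) : ℕ := ((d : ZMod c)⁻¹).val

/-- The sum `G_{γ,n}(c; β, χ)`. -/
noncomputable def Gsum (S : Matrix (Fin m) (Fin m) ℤ) (γ : Fin m → ℚ) (n : ℚ)
    (β : Fin m → ℚ) (Nβ : ℕ) (χ : DirichletCharacter ℂ Nβ) (c : ℕ) : ℂ :=
  ∑ ν ∈ (range Nβ).filter (fun ν => Nat.Coprime ν Nβ), χ (ν : ZMod Nβ) *
    ∑ d ∈ (range c).filter (fun d => Nat.Coprime d c),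
      ∑ r ∈ Fintype.piFinset (fun _ : Fin m => range c),
        eQ (((adInv c d : ℚ) * Qf S (ν • β + fun i => (r i : ℚ))
            - bil S γ (ν • β + fun i => (r i : ℚ))
            + (d : ℚ) * (Qf S γ + n)) / c)

/-- The Gauss sum `G(χ) = ∑_{u mod N, gcd(u,N)=1} χ(u) e(u/N)`. -/
noncomputable def gaussS (N : ℕ) (χ : DirichletCharacter ℂ N) : ℂ :=
  ∑ u ∈ (range N).filter (fun u => Nat.Coprime u N), χ (u : ZMod N) * eQ (u / N)

lemma eQ_add (x y : ℚ) : eQ (x + y) = eQ x * eQ y := by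
  simp only [eQ]
  rw [← Complex.exp_add]
  push_cast
  ring_nf

lemma eQ_intCast (z : ℤ) : eQ (z : ℚ) = 1 := by
  rw [eQ, Complex.exp_eq_one_iff]
  exact ⟨z, by push_cast; ring⟩

lemma eQ_eq_of_sub_int {x y : ℚ} (h : ∃ z : ℤ, x - y = z) : eQ x = eQ y := by
  obtain ⟨z, hz⟩ := h
  rw [show x = y + z by linarith, eQ_add, eQ_intCast, mul_one]

lemma eQ_eq_one_iff {x : ℚ} : eQ x = 1 ↔ ∃ z : ℤ, x = z := by
  constructor
  · intro h
    rw [eQ, Complex.exp_eq_one_iff] at h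
    obtain ⟨z, hz⟩ := h
    refine ⟨z, ?_⟩
    have h2 : (2 * Real.pi * Complex.I : ℂ) ≠ 0 := Complex.two_pi_I_ne_zero
    have : (x : ℂ) = (z : ℂ) := by
      apply mul_left_cancel₀ h2
      rw [hz]; ring
    exact_mod_cast this
  · rintro ⟨z, rfl⟩
    exact eQ_intCast z

lemma eQ_nat_mul (d : ℕ) (x : ℚ) : eQ (d * x) = eQ x ^ d := by
  simp only [eQ]
  rw [← Complex.exp_nat_mul]
  push_cast
  ring_nf

lemma eQ_intCast_div (N : ℕ) [NeZero N] (j : ℤ) :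
    eQ ((j : ℚ) / N) = ZMod.stdAddChar (N := N) (j : ZMod N) := by
  rw [ZMod.stdAddChar_coe, eQ]
  push_cast
  ring_nf

/-- Sums over residue representatives as sums over `ZMod N`. -/
lemma sum_range_eq_sum_zmod (N : ℕ) [NeZero N] (f : ℕ → ℂ) :
    ∑ i ∈ range N, f i = ∑ x : ZMod N, f x.val :=
  Finset.sum_nbij' (fun i => (i : ZMod N)) (fun x => x.val)
    (by simp) (by simp [ZMod.val_lt])
    (fun i hi => ZMod.val_natCast_of_lt (mem_range.1 hi)) (by simp)
    (fun i hi => by rw [ZMod.val_natCast_of_lt (mem_range.1 hi)])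

lemma sum_piFinset_eq_sum_zmod {m : ℕ} (c : ℕ) [NeZero c] (g : (Fin m → ℕ) → ℂ) :
    ∑ r ∈ Fintype.piFinset (fun _ : Fin m => range c), g r =
      ∑ s : Fin m → ZMod c, g (fun i => (s i).val) :=
  Finset.sum_nbij' (fun r i => (r i : ZMod c)) (fun s i => (s i).val)
    (by simp) (by simp [ZMod.val_lt])
    (fun r hr => by
      funext i
      exact ZMod.val_natCast_of_lt (mem_range.1 (Fintype.mem_piFinset.1 hr i)))
    (by simp)
    (fun r hr => by
      congr 1
      funext i
      exact (ZMod.val_natCast_of_lt (mem_range.1 (Fintype.mem_piFinset.1 hr i))).symm)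

/-- A sum of a periodic function over a full residue system is invariant under maps inducing
a permutation of the residue classes. -/
lemma sum_range_perm (N : ℕ) [NeZero N] (f : ℤ → ℂ)
    (hf : ∀ a b : ℤ, (a : ZMod N) = b → f a = f b) (σ : Equiv.Perm (ZMod N)) (T : ℤ → ℤ)
    (hT : ∀ a : ℤ, (T a : ZMod N) = σ a) :
    ∑ i ∈ range N, f (T i) = ∑ i ∈ range N, f i := by
  rw [sum_range_eq_sum_zmod N (fun i => f (T i)), sum_range_eq_sum_zmod N (fun i => f i),
    ← Equiv.sum_comp σ fun x : ZMod N => f x.val]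
  refine Finset.sum_congr rfl fun x _ => hf _ _ ?_
  rw [hT]
  simp

lemma sum_piFinset_perm {m : ℕ} (c : ℕ) [NeZero c] (g : (Fin m → ℤ) → ℂ)
    (hg : ∀ r s : Fin m → ℤ, (∀ i, (r i : ZMod c) = s i) → g r = g s)
    (σ : Equiv.Perm (Fin m → ZMod c)) (T : (Fin m → ℤ) → Fin m → ℤ)
    (hT : ∀ (r : Fin m → ℤ) (i : Fin m), (T r i : ZMod c) = σ (fun j => (r j : ZMod c)) i) :
    ∑ r ∈ Fintype.piFinset (fun _ : Fin m => range c), g (T fun i => (r i : ℤ)) =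
      ∑ r ∈ Fintype.piFinset (fun _ : Fin m => range c), g fun i => (r i : ℤ) := by
  rw [sum_piFinset_eq_sum_zmod c (fun r => g (T fun i => (r i : ℤ))),
    sum_piFinset_eq_sum_zmod c (fun r => g fun i => (r i : ℤ)),
    ← Equiv.sum_comp σ fun s : Fin m → ZMod c => g fun i => (s i).val]
  refine Finset.sum_congr rfl fun x _ => hg _ _ fun i => ?_
  rw [hT]
  simp

lemma sum_range_mul (N : ℕ) [NeZero N] (f : ℤ → ℂ)
    (hf : ∀ a b : ℤ, (a : ZMod N) = b → f a = f b) {d : ℕ} (hd : d.Coprime N) :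
    ∑ i ∈ range N, f (d * i) = ∑ i ∈ range N, f i :=
  sum_range_perm N f hf (Units.mulLeft (ZMod.unitOfCoprime d hd)) (fun a => d * a) (by simp)

lemma sum_range_add (N : ℕ) [NeZero N] (f : ℤ → ℂ)
    (hf : ∀ a b : ℤ, (a : ZMod N) = b → f a = f b) (k : ℤ) :
    ∑ i ∈ range N, f (i + k) = ∑ i ∈ range N, f i :=
  sum_range_perm N f hf (Equiv.addRight (k : ZMod N)) (fun a => a + k) (by simp)

lemma sum_piFinset_mul {m : ℕ} (c : ℕ) [NeZero c] (g : (Fin m → ℤ) → ℂ)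
    (hg : ∀ r s : Fin m → ℤ, (∀ i, (r i : ZMod c) = s i) → g r = g s) {d : ℕ}
    (hd : d.Coprime c) :
    ∑ r ∈ Fintype.piFinset (fun _ : Fin m => range c), g (fun i => (d : ℤ) * (r i : ℤ)) =
      ∑ r ∈ Fintype.piFinset (fun _ : Fin m => range c), g fun i => (r i : ℤ) :=
  sum_piFinset_perm c g hg
    (Equiv.piCongrRight fun _ => Units.mulLeft (ZMod.unitOfCoprime d hd))
    (fun r i => d * r i) (by simp)

lemma sum_piFinset_add {m : ℕ} (c : ℕ) [NeZero c] (g : (Fin m → ℤ) → ℂ)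
    (hg : ∀ r s : Fin m → ℤ, (∀ i, (r i : ZMod c) = s i) → g r = g s) (B : Fin m → ℤ) :
    ∑ r ∈ Fintype.piFinset (fun _ : Fin m => range c), g (fun i => (r i : ℤ) + B i) =
      ∑ r ∈ Fintype.piFinset (fun _ : Fin m => range c), g fun i => (r i : ℤ) :=
  sum_piFinset_perm c g hg
    (Equiv.piCongrRight fun i => Equiv.addRight (B i : ZMod c))
    (fun r i => r i + B i) (by simp)

/-- A sum over residues modulo `k * c` of a `c`-periodic function is `k ^ m` times the
sum over residues modulo `c`. -/
lemma sum_piFinset_range_mul {m : ℕ} (k c : ℕ) [NeZero c] (g : (Fin m → ℤ) → ℂ)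
    (hg : ∀ r s : Fin m → ℤ, (∀ i, (r i : ZMod c) = s i) → g r = g s) :
    ∑ r ∈ Fintype.piFinset (fun _ : Fin m => range (k * c)), g (fun i => (r i : ℤ)) =
      (k : ℂ) ^ m *
        ∑ r ∈ Fintype.piFinset (fun _ : Fin m => range c), g fun i => (r i : ℤ) := by
  have hc : 0 < c := Nat.pos_of_ne_zero (NeZero.ne c)
  have h1 : ∑ r ∈ Fintype.piFinset (fun _ : Fin m => range (k * c)), g (fun i => (r i : ℤ)) =
      ∑ q ∈ Fintype.piFinset (fun _ : Fin m => range k) ×ˢ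
        Fintype.piFinset (fun _ : Fin m => range c), g (fun i => (q.2 i : ℤ)) := by
    refine Finset.sum_nbij' (fun r => (fun i => r i / c, fun i => r i % c))
      (fun q i => q.2 i + c * q.1 i) ?_ ?_ ?_ ?_ ?_
    · intro r hr
      simp only [Fintype.mem_piFinset, mem_range, mem_product] at hr ⊢
      exact ⟨fun i => Nat.div_lt_of_lt_mul (by rw [mul_comm]; exact hr i),
        fun i => Nat.mod_lt _ hc⟩
    · rintro ⟨x, y⟩ hq
      simp only [Fintype.mem_piFinset, mem_range, mem_product] at hq ⊢
      intro i
      have := hq.1 i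
      have := hq.2 i
      nlinarith
    · intro r _
      funext i
      exact Nat.mod_add_div _ _
    · rintro ⟨x, y⟩ hq
      simp only [Fintype.mem_piFinset, mem_range, mem_product] at hq
      ext i
      · simp [Nat.add_mul_div_left _ _ hc, Nat.div_eq_of_lt (hq.2 i)]
      · simp [Nat.mod_eq_of_lt (hq.2 i)]
    · intro r _
      refine hg _ _ fun i => ?_
      simp
  rw [h1, Finset.sum_product]
  simp

lemma sum_range_eQ (M : ℕ) [NeZero M] (A : ℤ) :
    ∑ d ∈ range M, eQ ((d : ℚ) * A / M) = if (M : ℤ) ∣ A then (M : ℂ) else 0 := by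
  have hM : (M : ℚ) ≠ 0 := by exact_mod_cast NeZero.ne M
  have h0 : ∀ d : ℕ, eQ ((d : ℚ) * A / M) = eQ ((A : ℚ) / M) ^ d := fun d => by
    rw [mul_div_assoc, eQ_nat_mul]
  have h1 : eQ ((A : ℚ) / M) = 1 ↔ (M : ℤ) ∣ A := by
    rw [eQ_eq_one_iff]
    refine exists_congr fun z => ?_
    rw [div_eq_iff hM]
    constructor
    · intro h
      have : A = z * M := by exact_mod_cast h
      rw [this, mul_comm]
    · intro h
      rw [h]; push_cast; ring
  simp only [h0]
  split_ifs with h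
  · simp [h1.2 h]
  · have hne : eQ ((A : ℚ) / M) - 1 ≠ 0 := sub_ne_zero.2 fun h' => h (h1.1 h')
    apply mul_right_cancel₀ hne
    rw [geom_sum_mul, ← eQ_nat_mul, mul_div_cancel₀ _ hM, eQ_intCast]
    simp

/-- The Ramanujan sum modulo a prime power. -/
lemma sum_coprime_eQ {p : ℕ} (hp : p.Prime) (k : ℕ) (A : ℤ) :
    ∑ d ∈ (range (p ^ (k + 1))).filter (fun d => Nat.Coprime d (p ^ (k + 1))),
        eQ ((d : ℚ) * A / (p ^ (k + 1) : ℕ)) =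
      (if ((p ^ (k + 1) : ℕ) : ℤ) ∣ A then ((p ^ (k + 1) : ℕ) : ℂ) else 0) -
        if ((p ^ k : ℕ) : ℤ) ∣ A then ((p ^ k : ℕ) : ℂ) else 0 := by
  have : NeZero (p ^ k) := ⟨pow_ne_zero _ hp.ne_zero⟩
  have : NeZero (p ^ (k + 1)) := ⟨pow_ne_zero _ hp.ne_zero⟩
  rw [← sum_range_eQ, ← sum_range_eQ, eq_sub_iff_add_eq,
    ← Finset.sum_filter_add_sum_filter_not (range (p ^ (k + 1)))
      (fun d => Nat.Coprime d (p ^ (k + 1)))]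
  congr 1
  have hcop : ∀ d : ℕ, ¬ Nat.Coprime d (p ^ (k + 1)) ↔ p ∣ d := fun d => by
    rw [Nat.coprime_pow_right_iff (Nat.succ_pos k), Nat.coprime_comm, hp.coprime_iff_not_dvd,
      not_not]
  have hp0 : (p : ℚ) ≠ 0 := by exact_mod_cast hp.ne_zero
  refine Finset.sum_nbij' (fun d => p * d) (fun d => d / p) ?_ ?_ ?_ ?_ ?_
  · intro d hd
    rw [mem_range] at hd
    simp only [mem_filter, mem_range, hcop, dvd_mul_right, and_true]
    rw [pow_succ']
    exact Nat.mul_lt_mul_of_pos_left hd hp.pos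
  · intro d hd
    simp only [mem_filter, mem_range, hcop] at hd
    rw [mem_range]
    exact Nat.div_lt_of_lt_mul (by rw [← pow_succ']; exact hd.1)
  · intro d _
    exact Nat.mul_div_cancel_left _ hp.pos
  · intro d hd
    simp only [mem_filter, mem_range, hcop] at hd
    exact Nat.mul_div_cancel' hd.2
  · intro d _
    congr 1
    push_cast
    field_simp
    ring

lemma gaussS_eq_gaussSum (N : ℕ) [NeZero N] (χ : DirichletCharacter ℂ N) :
    gaussS N χ = gaussSum χ ZMod.stdAddChar := by
  rw [gaussS, Finset.sum_filter_of_ne, gaussSum,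
    sum_range_eq_sum_zmod N fun u => χ (u : ZMod N) * eQ (u / N)]
  · refine Finset.sum_congr rfl fun x _ => ?_
    have := eQ_intCast_div N x.val
    simp only [Int.cast_natCast, ZMod.natCast_zmod_val] at this ⊢
    rw [this]
  · intro u _ h
    by_contra hu
    apply h
    rw [MulChar.map_nonunit, zero_mul]
    rwa [ZMod.isUnit_iff_coprime]

/-- A primitive character is recovered from the Gauss sum expansion of its inverse. -/
lemma primitive_eq_sum {N : ℕ} [NeZero N] {χ : DirichletCharacter ℂ N} (hχ : χ.IsPrimitive)
    (a : ℤ) :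
    χ (a : ZMod N) = χ (-1) * gaussS N χ / N *
      ∑ u ∈ range N, (starRingEnd ℂ) (χ (u : ZMod N)) * eQ ((u : ℚ) * a / N) := by
  have h1 : (ZMod.dft.symm (ZMod.dft (χ : ZMod N → ℂ))) (a : ZMod N) = χ (a : ZMod N) := by
    rw [LinearEquiv.symm_apply_apply]
  rw [← h1, ZMod.invDFT_apply,
    sum_range_eq_sum_zmod N fun u => (starRingEnd ℂ) (χ (u : ZMod N)) * eQ ((u : ℚ) * a / N),
    gaussS_eq_gaussSum]
  simp only [smul_eq_mul, Finset.mul_sum]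
  refine Finset.sum_congr rfl fun x _ => ?_
  have h2 := eQ_intCast_div N (x.val * a)
  have h3 : χ⁻¹ (-1) = χ (-1) := by
    rw [MulChar.inv_apply, show (-1 : ZMod N) = ((-1 : (ZMod N)ˣ) : ZMod N) by simp,
      Ring.inverse_unit, inv_neg_one]
  have h4 : χ⁻¹ (-x) = χ⁻¹ (-1) * χ⁻¹ x := by rw [← map_mul, neg_one_mul]
  rw [hχ.fourierTransform_eq_inv_mul_gaussSum, h4, h3, ← MulChar.star_apply' χ x]
  push_cast at h2
  rw [h2, ZMod.natCast_zmod_val, starRingEnd_apply]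
  ring

lemma eq_of_periodic {N : ℕ} {f : ℤ → ℂ} (hf : ∀ x, f (x + N) = f x) (a b : ℤ)
    (hab : (a : ZMod N) = b) : f a = f b := by
  obtain ⟨k, hk⟩ := (ZMod.intCast_eq_intCast_iff_dvd_sub a b N).1 hab
  have h : Function.Periodic f (N : ℤ) := hf
  have := h.int_mul k a
  rw [← this]
  congr 1
  push_cast
  linarith [mul_comm (N : ℤ) k]

lemma eQ_congr_div {c : ℕ} [NeZero c] {x y : ℤ} (h : (x : ZMod c) = y) (z : ℚ) :
    eQ (((x : ℚ) + z) / c) = eQ (((y : ℚ) + z) / c) := by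
  have hc : (c : ℚ) ≠ 0 := by exact_mod_cast NeZero.ne c
  obtain ⟨k, hk⟩ := (ZMod.intCast_eq_intCast_iff_dvd_sub x y c).1 h
  refine eQ_eq_of_sub_int ⟨-k, ?_⟩
  have : (y : ℚ) - x = c * k := by exact_mod_cast hk
  field_simp
  push_cast
  linarith

/-- The substitution `(ν, r) ↦ (dν, dr)` in the sum over `ν` and `r`. -/
lemma sum_substitution {m N c : ℕ} [NeZero N] [NeZero c] (χ : DirichletCharacter ℂ N)
    (q : ℤ → (Fin m → ℤ) → ℤ) (l : (Fin m → ℤ) → ℤ) (b h : ℤ) (B : Fin m → ℤ)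
    (hq : ∀ ν r s, (∀ i, (r i : ZMod c) = s i) → (q ν r : ZMod c) = q ν s)
    (hl : ∀ r s, (∀ i, (r i : ZMod c) = s i) → (l r : ZMod c) = l s)
    (hqN : ∀ ν r, q (ν + N) r = q ν fun i => r i + B i)
    (hlB : ∀ r, l (fun i => r i + B i) = l r + b)
    (hqd : ∀ (d ν : ℤ) r, q (d * ν) (fun i => d * r i) = d ^ 2 * q ν r)
    (hld : ∀ (d : ℤ) r, l (fun i => d * r i) = d * l r)
    (d : ℕ) (hdc : d.Coprime c) (hdN : d.Coprime N) :
    ∑ ν ∈ (range N).filter (fun ν => Nat.Coprime ν N), χ (ν : ZMod N) *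
        ∑ r ∈ Fintype.piFinset (fun _ : Fin m => range c),
          eQ (((adInv c d : ℚ) * q ν (fun i => r i) - ((ν : ℚ) * b / N + l (fun i => r i))
            + d * h) / c) =
      ∑ ν ∈ range N, χ (((d * ν : ℕ) : ℤ) : ZMod N) *
        ∑ r ∈ Fintype.piFinset (fun _ : Fin m => range c),
          eQ ((d : ℚ) * (q ν (fun i => r i) - l (fun i => r i) - ν * b / N + h) / c) := by
  have hN : (N : ℚ) ≠ 0 := by exact_mod_cast NeZero.ne N
  set g : ℤ → (Fin m → ℤ) → ℂ := fun ν r =>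
    eQ (((adInv c d : ℚ) * q ν r - ((ν : ℚ) * b / N + l r) + d * h) / c) with hg
  have hgr : ∀ ν r s, (∀ i, (r i : ZMod c) = s i) → g ν r = g ν s := by
    intro ν r s hrs
    have := eQ_congr_div (c := c) (x := adInv c d * q ν r - l r) (y := adInv c d * q ν s - l s)
      (by push_cast; rw [hq ν r s hrs, hl r s hrs]) (d * h - ν * b / N)
    simp only [hg]
    push_cast at this
    convert this using 2 <;> ring
  set F : ℤ → ℂ := fun ν => χ (ν : ZMod N) *
    ∑ r ∈ Fintype.piFinset (fun _ : Fin m => range c), g ν (fun i => r i) with hF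
  have hFN : ∀ ν, F (ν + N) = F ν := by
    intro ν
    simp only [hF]
    rw [← sum_piFinset_add c (g ν) (hgr ν) B]
    congr 1
    · push_cast; simp
    · refine Finset.sum_congr rfl fun r _ => ?_
      simp only [hg]
      rw [hqN, hlB (fun i => (r i : ℤ))]
      congr 1
      push_cast
      field_simp
      ring
  have h1 := sum_range_mul N F (eq_of_periodic hFN) hdN
  rw [Finset.sum_filter_of_ne]
  · refine Eq.trans (Eq.trans ?_ h1.symm) ?_
    · simp [hF, hg]
    · refine Finset.sum_congr rfl fun ν _ => ?_
      simp only [hF]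
      rw [← sum_piFinset_mul c (g (d * ν)) (hgr _) hdc]
      congr 1
      refine Finset.sum_congr rfl fun r _ => ?_
      simp only [hg]
      rw [hqd, hld]
      have hinv : ((adInv c d * (d ^ 2 * q ν fun i => r i) : ℤ) : ZMod c) =
          ((d * q ν (fun i => r i) : ℤ) : ZMod c) := by
        have h2 : ((adInv c d : ℕ) : ZMod c) * d = 1 := by
          rw [adInv, ZMod.natCast_zmod_val, mul_comm, ZMod.coe_mul_inv_eq_one _ hdc]
        push_cast
        linear_combination (d * (q ν fun i => r i) : ZMod c) * h2
      have := eQ_congr_div hinv (d * h - d * ν * b / N - d * l (fun i => r i))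
      push_cast at this ⊢
      convert this using 2 <;> ring
  · intro ν _ hne
    by_contra hu
    apply hne
    rw [MulChar.map_nonunit, zero_mul]
    rwa [ZMod.isUnit_iff_coprime]

/-- Translating `ν` by `c` multiplies the sum by a root of unity, so that it
vanishes unless `c u ≡ b` modulo `N`. -/
lemma sum_eq_zero_of_not_dvd {m N c : ℕ} [NeZero N] [NeZero c]
    (q : ℤ → (Fin m → ℤ) → ℤ) (l : (Fin m → ℤ) → ℤ) (b h : ℤ) (B : Fin m → ℤ)
    (hq : ∀ ν r s, (∀ i, (r i : ZMod c) = s i) → (q ν r : ZMod c) = q ν s)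
    (hl : ∀ r s, (∀ i, (r i : ZMod c) = s i) → (l r : ZMod c) = l s)
    (hqN : ∀ ν r, q (ν + N) r = q ν fun i => r i + B i)
    (hlB : ∀ r, l (fun i => r i + B i) = l r + b)
    (hqc : ∀ ν r, (q (ν + c) r : ZMod c) = q ν r)
    (d u : ℕ) (hdN : d.Coprime N) (hu : ¬ (N : ℤ) ∣ u * c - b) :
    ∑ ν ∈ range N, ∑ r ∈ Fintype.piFinset (fun _ : Fin m => range c),
      eQ ((d : ℚ) * (q ν (fun i => r i) - l (fun i => r i) - ν * b / N + h
        + c * ν * u / N) / c) = 0 := by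
  have hN : (N : ℚ) ≠ 0 := by exact_mod_cast NeZero.ne N
  have hc : (c : ℚ) ≠ 0 := by exact_mod_cast NeZero.ne c
  set g : ℤ → (Fin m → ℤ) → ℂ := fun ν r =>
    eQ ((d : ℚ) * (q ν r - l r - ν * b / N + h + c * ν * u / N) / c) with hg
  have hgr : ∀ ν r s, (∀ i, (r i : ZMod c) = s i) → g ν r = g ν s := by
    intro ν r s hrs
    have := eQ_congr_div (c := c) (x := d * (q ν r - l r)) (y := d * (q ν s - l s))
      (by push_cast; rw [hq ν r s hrs, hl r s hrs])
      (d * (h - ν * b / N + c * ν * u / N))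
    simp only [hg]
    push_cast at this
    convert this using 2 <;> ring
  set F : ℤ → ℂ := fun ν =>
    ∑ r ∈ Fintype.piFinset (fun _ : Fin m => range c), g ν (fun i => r i) with hF
  have hFN : ∀ ν, F (ν + N) = F ν := by
    intro ν
    simp only [hF]
    rw [← sum_piFinset_add c (g ν) (hgr ν) B]
    refine Finset.sum_congr rfl fun r _ => ?_
    simp only [hg]
    rw [hqN, hlB (fun i => (r i : ℤ))]
    refine eQ_eq_of_sub_int ⟨d * u, ?_⟩
    push_cast
    field_simp
    ring
  have hFc : ∀ ν, F (ν + c) = eQ ((d : ℚ) * (u * c - b) / N) * F ν := by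
    intro ν
    simp only [hF, Finset.mul_sum]
    refine Finset.sum_congr rfl fun r _ => ?_
    simp only [hg]
    rw [← eQ_add]
    have := eQ_congr_div (c := c) (x := d * q (ν + c) (fun i => r i))
      (y := d * q ν (fun i => r i)) (by push_cast; rw [hqc])
      (d * (- l (fun i => r i) - (ν + c : ℤ) * b / N + h + c * (ν + c : ℤ) * u / N))
    push_cast at this ⊢
    refine Eq.trans (Eq.trans ?_ this) ?_
    · congr 1; ring
    · congr 1
      field_simp
      ring
  have h1 := sum_range_add N F (eq_of_periodic hFN) c
  simp only [hFc, ← Finset.mul_sum] at h1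
  have hne : eQ ((d : ℚ) * (u * c - b) / N) ≠ 1 := by
    rw [Ne, eQ_eq_one_iff]
    rintro ⟨z, hz⟩
    rw [div_eq_iff hN] at hz
    have hz' : (d : ℤ) * (u * c - b) = z * N := by exact_mod_cast hz
    have hcop : IsCoprime (N : ℤ) d :=
      Int.isCoprime_iff_gcd_eq_one.2 (by simpa [Nat.coprime_comm] using hdN)
    exact hu (hcop.dvd_of_dvd_mul_left
      (⟨z, by rw [hz', mul_comm]⟩ : (N : ℤ) ∣ d * (u * c - b)))
  have h2 : (eQ ((d : ℚ) * (u * c - b) / N) - 1) * ∑ ν ∈ range N, F ν = 0 := by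
    rw [sub_mul, h1, one_mul, sub_self]
  simpa [hF, hg] using (mul_eq_zero.1 h2).resolve_left (sub_ne_zero.2 hne)

/-- Opening the primitive character through its Gauss sum turns the twisted sum into
a combination of Ramanujan sums. -/
lemma twisted_sum_eq {m N c : ℕ} [NeZero N] [NeZero c] {χ : DirichletCharacter ℂ N}
    (hχ : χ.IsPrimitive)
    (q : ℤ → (Fin m → ℤ) → ℤ) (l : (Fin m → ℤ) → ℤ) (b h : ℤ) (B : Fin m → ℤ)
    (hq : ∀ ν r s, (∀ i, (r i : ZMod c) = s i) → (q ν r : ZMod c) = q ν s)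
    (hl : ∀ r s, (∀ i, (r i : ZMod c) = s i) → (l r : ZMod c) = l s)
    (hqN : ∀ ν r, q (ν + N) r = q ν fun i => r i + B i)
    (hlB : ∀ r, l (fun i => r i + B i) = l r + b)
    (hqd : ∀ (d ν : ℤ) r, q (d * ν) (fun i => d * r i) = d ^ 2 * q ν r)
    (hld : ∀ (d : ℤ) r, l (fun i => d * r i) = d * l r)
    (hqc : ∀ ν r, (q (ν + c) r : ZMod c) = q ν r)
    (hcop : ∀ d : ℕ, d.Coprime c → d.Coprime N) :
    ∑ ν ∈ (range N).filter (fun ν => Nat.Coprime ν N), χ (ν : ZMod N) *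
        ∑ d ∈ (range c).filter (fun d => Nat.Coprime d c),
          ∑ r ∈ Fintype.piFinset (fun _ : Fin m => range c),
            eQ (((adInv c d : ℚ) * q ν (fun i => r i) - ((ν : ℚ) * b / N + l (fun i => r i))
              + d * h) / c) =
      χ (-1) * gaussS N χ / N *
        ∑ u ∈ (range N).filter (fun u : ℕ => (N : ℤ) ∣ u * c - b),
          (starRingEnd ℂ) (χ (u : ZMod N)) *
            ∑ ν ∈ range N, ∑ r ∈ Fintype.piFinset (fun _ : Fin m => range c),
              ∑ d ∈ (range c).filter (fun d => Nat.Coprime d c),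
                eQ ((d : ℚ) * (q ν (fun i => r i) - l (fun i => r i) - ν * b / N + h
                  + c * ν * u / N) / c) := by
  have hN : (N : ℚ) ≠ 0 := by exact_mod_cast NeZero.ne N
  have hc : (c : ℚ) ≠ 0 := by exact_mod_cast NeZero.ne c
  have hstep : ∀ d ∈ (range c).filter (fun d => Nat.Coprime d c),
      ∑ ν ∈ (range N).filter (fun ν => Nat.Coprime ν N), χ (ν : ZMod N) *
        ∑ r ∈ Fintype.piFinset (fun _ : Fin m => range c),
          eQ (((adInv c d : ℚ) * q ν (fun i => r i) - ((ν : ℚ) * b / N + l (fun i => r i))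
            + d * h) / c) =
      χ (-1) * gaussS N χ / N *
        ∑ u ∈ (range N).filter (fun u : ℕ => (N : ℤ) ∣ u * c - b),
          (starRingEnd ℂ) (χ (u : ZMod N)) *
            ∑ ν ∈ range N, ∑ r ∈ Fintype.piFinset (fun _ : Fin m => range c),
              eQ ((d : ℚ) * (q ν (fun i => r i) - l (fun i => r i) - ν * b / N + h
                + c * ν * u / N) / c) := by
    intro d hd
    have hdc := (mem_filter.1 hd).2
    rw [sum_substitution χ q l b h B hq hl hqN hlB hqd hld d hdc (hcop d hdc),
      Finset.sum_filter_of_ne]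
    · simp only [primitive_eq_sum hχ, Finset.mul_sum, Finset.sum_mul]
      rw [Finset.sum_congr rfl fun ν _ => Finset.sum_comm, Finset.sum_comm]
      refine Finset.sum_congr rfl fun u _ => Finset.sum_congr rfl fun ν _ =>
        Finset.sum_congr rfl fun r _ => ?_
      rw [mul_assoc, mul_assoc, ← eQ_add]
      congr 3
      push_cast
      field_simp
      ring
    · intro u _ hne
      by_contra hu
      exact hne (by
        rw [sum_eq_zero_of_not_dvd q l b h B hq hl hqN hlB hqc d u (hcop d hdc) hu, mul_zero])
  simp only [Finset.mul_sum (s := (range c).filter _)]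
  rw [Finset.sum_comm, Finset.sum_congr rfl hstep, ← Finset.mul_sum, Finset.sum_comm]
  congr 1
  refine Finset.sum_congr rfl fun u _ => ?_
  rw [← Finset.mul_sum, Finset.sum_comm]
  congr 1
  exact Finset.sum_congr rfl fun ν _ => Finset.sum_comm

lemma bil_add_left (S : Matrix (Fin m) (Fin m) ℤ) (x y z : Fin m → ℚ) :
    bil S (x + y) z = bil S x z + bil S y z := by
  simp [bil, add_dotProduct]

lemma bil_add_right (S : Matrix (Fin m) (Fin m) ℤ) (x y z : Fin m → ℚ) :
    bil S x (y + z) = bil S x y + bil S x z := by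
  simp [bil, mulVec_add, dotProduct_add]

lemma bil_smul_left (S : Matrix (Fin m) (Fin m) ℤ) (a : ℚ) (x y : Fin m → ℚ) :
    bil S (a • x) y = a * bil S x y := by
  simp [bil]

lemma bil_smul_right (S : Matrix (Fin m) (Fin m) ℤ) (a : ℚ) (x y : Fin m → ℚ) :
    bil S x (a • y) = a * bil S x y := by
  simp [bil, mulVec_smul]

lemma bil_comm {S : Matrix (Fin m) (Fin m) ℤ} (hS : S.IsSymm) (x y : Fin m → ℚ) :
    bil S x y = bil S y x := by
  rw [bil, bil, dotProduct_mulVec, dotProduct_comm, ← mulVec_transpose, ← transpose_map, hS.eq]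

lemma Qf_add {S : Matrix (Fin m) (Fin m) ℤ} (hS : S.IsSymm) (x y : Fin m → ℚ) :
    Qf S (x + y) = Qf S x + bil S x y + Qf S y := by
  simp only [Qf, bil_add_left, bil_add_right, bil_comm hS y x]
  ring

lemma Qf_smul (S : Matrix (Fin m) (Fin m) ℤ) (a : ℚ) (x : Fin m → ℚ) :
    Qf S (a • x) = a ^ 2 * Qf S x := by
  simp only [Qf, bil_smul_left, bil_smul_right]
  ring

lemma bil_intCast (S : Matrix (Fin m) (Fin m) ℤ) (r s : Fin m → ℤ) :
    bil S (fun i => (r i : ℚ)) (fun i => (s i : ℚ)) = ((r ⬝ᵥ S.mulVec s : ℤ) : ℚ) := by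
  simp [bil, dotProduct, mulVec]

/-- An even lattice has integral quadratic form. -/
lemma Qf_intCast {S : Matrix (Fin m) (Fin m) ℤ} (hS : S.IsSymm) (heven : ∀ i, 2 ∣ S i i)
    (r : Fin m → ℤ) : ∃ z : ℤ, Qf S (fun i => (r i : ℚ)) = z := by
  have h : ((r ⬝ᵥ S.mulVec r : ℤ) : ZMod 2) = 0 := by
    have hexp : r ⬝ᵥ S.mulVec r =
        ∑ q ∈ (univ : Finset (Fin m)) ×ˢ univ, r q.1 * (S q.1 q.2 * r q.2) := by
      rw [Finset.sum_product]
      simp [dotProduct, mulVec, Finset.mul_sum]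
    rw [hexp]
    push_cast
    refine Finset.sum_involution (fun q _ => q.swap) ?_ ?_ ?_ ?_
    · intro q _
      have : S q.2 q.1 = S q.1 q.2 := hS.apply _ _
      simp only [Prod.fst_swap, Prod.snd_swap, this]
      have h2 : (2 : ZMod 2) = 0 := by decide
      linear_combination (r q.1 * S q.1 q.2 * r q.2 : ZMod 2) * h2
    · rintro ⟨i, j⟩ _ hne hij
      have hij' : j = i := by simpa using congrArg Prod.fst hij
      subst hij'
      apply hne
      have : (S j j : ZMod 2) = 0 := (ZMod.intCast_zmod_eq_zero_iff_dvd _ 2).2 (heven j)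
      simp [this]
    · simp
    · simp
  obtain ⟨k, hk⟩ := (ZMod.intCast_zmod_eq_zero_iff_dvd _ 2).1 h
  refine ⟨k, ?_⟩
  rw [Qf, bil_intCast, hk]
  push_cast
  ring

lemma repNum_eq_sum {S : Matrix (Fin m) (Fin m) ℤ} {γ : Fin m → ℚ} {n : ℚ} (a : ℕ)
    (w : (Fin m → ℤ) → ℤ) (hw : ∀ r : Fin m → ℤ, Qf S ((fun i => (r i : ℚ)) - γ) + n = w r) :
    (repNum S γ n a : ℂ) = ∑ r ∈ Fintype.piFinset (fun _ : Fin m => range a),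
      if (a : ℤ) ∣ w (fun i => r i) then 1 else 0 := by
  classical
  rw [repNum, Nat.card_eq_fintype_card, Fintype.card_subtype, Finset.sum_boole]
  congr 1
  have hiff : ∀ r : Fin m → ℕ, (∃ t : ℤ, Qf S ((fun i => (r i : ℚ)) - γ) + n = (a : ℚ) * t) ↔
      (a : ℤ) ∣ w (fun i => r i) := by
    intro r
    have := hw fun i => r i
    simp only [Int.cast_natCast] at this
    rw [this]
    exact exists_congr fun t => by exact_mod_cast Iff.rfl
  refine Finset.card_bij (fun r _ i => (r i : ℕ)) ?_ ?_ ?_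
  · intro r hr
    rw [mem_filter] at hr ⊢
    exact ⟨by simp, (hiff fun i => r i).1 hr.2⟩
  · intro r _ s _ h
    funext i
    exact Fin.ext (congrFun h i)
  · intro r hr
    rw [mem_filter, Fintype.mem_piFinset] at hr
    refine ⟨fun i => ⟨r i, mem_range.1 (hr.1 i)⟩, ?_, rfl⟩
    rw [mem_filter]
    exact ⟨mem_univ _, (hiff r).2 hr.2⟩

/-- Summing Ramanujan sums over an integral form yields a difference of representation
numbers. -/
lemma sum_ramanujan_eq_repNum {S : Matrix (Fin m) (Fin m) ℤ} {γ : Fin m → ℚ} {n : ℚ} {p : ℕ}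
    (hp : p.Prime) (hm : 1 ≤ m) (k : ℕ) (w : (Fin m → ℤ) → ℤ)
    (hw : ∀ r : Fin m → ℤ, Qf S ((fun i => (r i : ℚ)) - γ) + n = w r)
    (hwc : ∀ r s, (∀ i, (r i : ZMod (p ^ k)) = s i) → (w r : ZMod (p ^ k)) = w s) :
    ∑ r ∈ Fintype.piFinset (fun _ : Fin m => range (p ^ (k + 1))),
        ∑ d ∈ (range (p ^ (k + 1))).filter (fun d => Nat.Coprime d (p ^ (k + 1))),
          eQ ((d : ℚ) * w (fun i => r i) / (p ^ (k + 1) : ℕ)) =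
      (p : ℂ) ^ (k + 1) *
        ((repNum S γ n (p ^ (k + 1)) : ℂ) - (p : ℂ) ^ (m - 1) * repNum S γ n (p ^ k)) := by
  have : NeZero (p ^ k) := ⟨pow_ne_zero _ hp.ne_zero⟩
  have h1 := sum_piFinset_range_mul (m := m) p (p ^ k)
    (fun r => if ((p ^ k : ℕ) : ℤ) ∣ w r then (1 : ℂ) else 0) (by
      intro r s hrs
      have := hwc r s hrs
      simp only [← ZMod.intCast_zmod_eq_zero_iff_dvd, this])
  rw [← pow_succ'] at h1
  rw [repNum_eq_sum (p ^ (k + 1)) w hw, repNum_eq_sum (p ^ k) w hw]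
  simp only [sum_coprime_eQ hp]
  rw [Finset.sum_sub_distrib]
  have h2 : ∀ (j : ℕ) (P : Finset (Fin m → ℕ)),
      ∑ r ∈ P, (if ((p ^ j : ℕ) : ℤ) ∣ w (fun i => r i) then ((p ^ j : ℕ) : ℂ) else 0) =
        (p : ℂ) ^ j * ∑ r ∈ P, if ((p ^ j : ℕ) : ℤ) ∣ w (fun i => r i) then 1 else 0 := by
    intro j P
    rw [Finset.mul_sum]
    simp
  rw [h2, h2, h1]
  obtain ⟨m, rfl⟩ := Nat.exists_eq_add_of_le' hm
  simp only [Nat.add_sub_cancel]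
  ring

/-- evaluation of `G_{γ,n}(p^α; β, χ)` for `α ≥ ν_p(g)` when `N_β = p^v`
and `χ` is primitive modulo `N_β`. -/
theorem Gsum_prime_power_eval (m : ℕ) (hm : 1 ≤ m) (S : Matrix (Fin m) (Fin m) ℤ)
    (hSsymm : S.IsSymm) (hSeven : ∀ i, 2 ∣ S i i) (hSdet : S.det ≠ 0)
    (γ : Fin m → ℚ) (hγ : memDual S γ) (n : ℚ) (hn : ∃ z : ℤ, n + Qf S γ = z)
    (β : Fin m → ℚ) (hβ : memDual S β) (hβiso : ∃ z : ℤ, Qf S β = z)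
    (Nβ : ℕ) (hNβ : isOrderOf β Nβ)
    (χ : DirichletCharacter ℂ Nβ) (hχ : χ.IsPrimitive)
    (b : ℤ) (hb : (b : ℚ) = Nβ * bil S γ β)
    (p : ℕ) (hp : p.Prime) (hpg : p ∣ Int.gcd (Nβ : ℤ) b)
    (v : ℕ) (hv : Nβ = p ^ v)
    (α : ℕ) (hα : padicValNat p (Int.gcd (Nβ : ℤ) b) ≤ α) :
    (∀ u ∈ (range (p ^ v)).filter
        (fun u => Nat.Coprime u p ∧ (p : ℤ) ^ v ∣ (u : ℤ) * (p : ℤ) ^ α - b),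
      ∀ ν ∈ range (p ^ v),
        ∃ z : ℤ, (n + (p : ℚ) ^ α * ν * u / (p : ℚ) ^ v) + Qf S (γ - ν • β) = z) ∧
    Gsum S γ n β Nβ χ (p ^ α) =
      χ (-1) * gaussS Nβ χ * (p : ℂ) ^ ((α : ℤ) - (v : ℤ)) *
        ∑ u ∈ (range (p ^ v)).filter
            (fun u => Nat.Coprime u p ∧ (p : ℤ) ^ v ∣ (u : ℤ) * (p : ℤ) ^ α - b),
          (starRingEnd ℂ) (χ (u : ZMod Nβ)) *
            ∑ ν ∈ range (p ^ v),
              ((repNum S (γ - ν • β) (n + (p : ℚ) ^ α * ν * u / (p : ℚ) ^ v) (p ^ α) : ℂ) -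
                (p : ℂ) ^ (m - 1) *
                  (repNum S (γ - ν • β) (n + (p : ℚ) ^ α * ν * u / (p : ℚ) ^ v)
                    (p ^ (α - 1)) : ℂ)) := by
  subst hv
  have hg0 : Int.gcd ((p ^ v : ℕ) : ℤ) b ≠ 0 := by
    rw [Ne, Int.gcd_eq_zero_iff]
    rintro ⟨h, -⟩
    exact pow_ne_zero v hp.ne_zero (by exact_mod_cast h)
  have hv0 : v ≠ 0 := by
    rintro rfl
    exact hp.one_lt.ne' (by simpa using hpg)
  have : Fact p.Prime := ⟨hp⟩
  obtain ⟨k, rfl⟩ : ∃ k, α = k + 1 :=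
    Nat.exists_eq_add_of_le' ((one_le_padicValNat_of_dvd hg0 hpg).trans hα)
  have : NeZero (p ^ v) := ⟨pow_ne_zero _ hp.ne_zero⟩
  have : NeZero (p ^ (k + 1)) := ⟨pow_ne_zero _ hp.ne_zero⟩
  have hpQ : (p : ℚ) ≠ 0 := by exact_mod_cast hp.ne_zero
  have hNQ : (p : ℚ) ^ v ≠ 0 := pow_ne_zero _ hpQ
  obtain ⟨h, hh⟩ := hn
  obtain ⟨q₀, hq₀⟩ := hβiso
  choose l hl using hγ
  choose t ht using hβ
  choose B hB using hNβ.2.1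
  choose Q₀ hQ₀ using Qf_intCast hSsymm hSeven
  have hγβ : bil S γ β = b / (p : ℚ) ^ v := by
    rw [hb]; push_cast; field_simp
  have hcast_add : ∀ r s : Fin m → ℤ, (fun i => ((r i + s i : ℤ) : ℚ)) =
      (fun i => (r i : ℚ)) + fun i => (s i : ℚ) := fun r s => by funext i; simp
  have hcast_mul : ∀ (d : ℤ) (r : Fin m → ℤ), (fun i => ((d * r i : ℤ) : ℚ)) =
      (d : ℚ) • fun i => (r i : ℚ) := fun d r => by funext i; simp
  have hB' : (fun i => (B i : ℚ)) = (p : ℚ) ^ v • β := by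
    funext i
    rw [← hB]; simp
  have hl_add : ∀ r s : Fin m → ℤ, l (fun i => r i + s i) = l r + l s := fun r s => by
    have := hl fun i => r i + s i
    rw [hcast_add, bil_add_right, hl, hl] at this
    exact_mod_cast this.symm
  have hl_mul : ∀ (d : ℤ) (r : Fin m → ℤ), l (fun i => d * r i) = d * l r := fun d r => by
    have := hl fun i => d * r i
    rw [hcast_mul, bil_smul_right, hl] at this
    exact_mod_cast this.symm
  have hlB : ∀ r : Fin m → ℤ, l (fun i => r i + B i) = l r + b := fun r => by
    have := hl B
    rw [hB', bil_smul_right, hγβ, mul_div_cancel₀ _ hNQ] at this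
    rw [hl_add, show b = l B by exact_mod_cast this]
  set q : ℤ → (Fin m → ℤ) → ℤ := fun ν r => ν ^ 2 * q₀ + ν * t r + Q₀ r with hqdef
  have hq : ∀ (ν : ℤ) (r : Fin m → ℤ),
      Qf S ((ν : ℚ) • β + fun i => (r i : ℚ)) = q ν r := fun ν r => by
    rw [Qf_add hSsymm, Qf_smul, bil_smul_left, hq₀, ht, hQ₀]
    push_cast [hqdef]
    ring
  have hbil : ∀ (ν : ℤ) (r : Fin m → ℤ),
      bil S γ ((ν : ℚ) • β + fun i => (r i : ℚ)) = ν * b / (p : ℚ) ^ v + l r := fun ν r => by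
    rw [bil_add_right, bil_smul_right, hγβ, hl]
    ring
  have hshift : ∀ (ν : ℤ) (r : Fin m → ℤ),
      Qf S ((fun i => (r i : ℚ)) - (γ - (ν : ℚ) • β)) + n =
        q ν r - l r - ν * b / (p : ℚ) ^ v + h := fun ν r => by
    have hX : (fun i => (r i : ℚ)) - (γ - (ν : ℚ) • β) =
        ((ν : ℚ) • β + fun i => (r i : ℚ)) + (-1 : ℚ) • γ := by
      rw [neg_one_smul]; abel
    rw [hX, Qf_add hSsymm, Qf_smul, bil_smul_right, bil_comm hSsymm _ γ, hbil, hq, ← hh]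
    ring
  have hcong : ∀ (c : ℕ) (r s : Fin m → ℤ), (∀ i, (r i : ZMod c) = s i) →
      ∃ x : Fin m → ℤ, r = fun i => s i + c * x i := fun c r s hrs => by
    choose x hx using fun i =>
      (ZMod.intCast_eq_intCast_iff_dvd_sub (s i) (r i) c).1 (hrs i).symm
    exact ⟨x, by funext i; linarith [hx i]⟩
  have hl_congr : ∀ (c : ℕ) (r s : Fin m → ℤ), (∀ i, (r i : ZMod c) = s i) →
      (l r : ZMod c) = l s := fun c r s hrs => by
    obtain ⟨x, rfl⟩ := hcong c r s hrs
    rw [hl_add s fun i => c * x i, hl_mul]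
    simp
  have hq_congr : ∀ (c : ℕ) (ν : ℤ) (r s : Fin m → ℤ), (∀ i, (r i : ZMod c) = s i) →
      (q ν r : ZMod c) = q ν s := fun c ν r s hrs => by
    obtain ⟨x, rfl⟩ := hcong c r s hrs
    have h1 := hq ν fun i => s i + c * x i
    rw [hcast_add s fun i => c * x i, hcast_mul c x, ← add_assoc, Qf_add hSsymm, hq,
      bil_smul_right, bil_add_left, bil_smul_left, ht, bil_intCast, Qf_smul, hQ₀] at h1
    have h2 : q ν (fun i => s i + c * x i) =
        q ν s + c * (ν * t x + s ⬝ᵥ S.mulVec x + c * Q₀ x) := by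
      have : ((q ν (fun i => s i + c * x i) : ℤ) : ℚ) =
        ((q ν s + c * (ν * t x + s ⬝ᵥ S.mulVec x + c * Q₀ x) : ℤ) : ℚ) := by
        rw [← h1]; push_cast; ring
      exact_mod_cast this
    rw [h2]
    simp
  have hqN : ∀ (ν : ℤ) (r : Fin m → ℤ),
      q (ν + (p ^ v : ℕ)) r = q ν fun i => r i + B i := fun ν r => by
    have h1 := hq (ν + (p ^ v : ℕ)) r
    have h2 := hq ν fun i => r i + B i
    rw [hcast_add, hB'] at h2
    have h3 : (((ν + (p ^ v : ℕ) : ℤ) : ℚ) • β + fun i => (r i : ℚ)) =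
        (ν : ℚ) • β + ((fun i => (r i : ℚ)) + (p : ℚ) ^ v • β) := by
      push_cast
      rw [add_smul]
      abel
    rw [h3, h2] at h1
    exact_mod_cast h1.symm
  have hqd : ∀ (d ν : ℤ) (r : Fin m → ℤ), q (d * ν) (fun i => d * r i) = d ^ 2 * q ν r :=
    fun d ν r => by
      have h1 := hq (d * ν) fun i => d * r i
      rw [hcast_mul, Int.cast_mul, mul_smul, ← smul_add, Qf_smul, hq] at h1
      exact_mod_cast h1.symm
  have hqc : ∀ (c : ℕ) (ν : ℤ) (r : Fin m → ℤ), (q (ν + c) r : ZMod c) = q ν r :=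
    fun c ν r => by simp [hqdef]
  have hgood : ∀ (u ν : ℕ) (r : Fin m → ℤ) (z : ℤ), u * (p : ℤ) ^ (k + 1) - b = p ^ v * z →
      Qf S ((fun i => (r i : ℚ)) - (γ - ν • β)) + (n + (p : ℚ) ^ (k + 1) * ν * u / (p : ℚ) ^ v) =
        ((q ν r - l r + h + ν * z : ℤ) : ℚ) := fun u ν r z hz => by
    have h1 := hshift ν r
    rw [Int.cast_natCast, Nat.cast_smul_eq_nsmul] at h1
    have hz' : (u : ℚ) * (p : ℚ) ^ (k + 1) - b = p ^ v * z := by exact_mod_cast hz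
    rw [← add_assoc, h1]
    push_cast
    field_simp
    linear_combination (ν : ℚ) * hz'
  refine ⟨fun u hu ν _ => ?_, ?_⟩
  · obtain ⟨z, hz⟩ := (mem_filter.1 hu).2.2
    have h1 := hgood u ν 0 z hz
    have h2 : (fun i => (((0 : Fin m → ℤ) i : ℤ) : ℚ)) - (γ - ν • β) = (-1 : ℚ) • (γ - ν • β) := by
      funext i; simp
    rw [h2, Qf_smul] at h1
    exact ⟨_, by rw [← h1]; ring⟩
  have hmain := twisted_sum_eq (c := p ^ (k + 1)) hχ q l b h B (hq_congr _) (hl_congr _) hqN hlB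
    hqd hl_mul (hqc _) (fun d hd => by
      rw [Nat.coprime_pow_right_iff (Nat.succ_pos k)] at hd
      exact hd.pow_right v)
  refine Eq.trans (Eq.trans ?_ hmain) ?_
  · refine Finset.sum_congr rfl fun ν _ => congrArg _ <| Finset.sum_congr rfl fun d _ =>
      Finset.sum_congr rfl fun r _ => ?_
    have h1 := hq ν fun i => r i
    have h2 := hbil ν fun i => r i
    simp only [Int.cast_natCast, Nat.cast_smul_eq_nsmul] at h1 h2
    rw [h1, h2, add_comm (Qf S γ) n, hh]
    push_cast
    rfl
  have hpC : (p : ℂ) ≠ 0 := by exact_mod_cast hp.ne_zero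
  have hpow : χ (-1) * gaussS (p ^ v) χ * (p : ℂ) ^ (((k + 1 : ℕ) : ℤ) - (v : ℤ)) =
      χ (-1) * gaussS (p ^ v) χ / (p ^ v : ℕ) * (p : ℂ) ^ (k + 1) := by
    rw [zpow_sub₀ hpC, zpow_natCast, zpow_natCast]
    push_cast
    ring
  rw [hpow, mul_assoc, Finset.mul_sum (a := (p : ℂ) ^ (k + 1))]
  congr 1
  have hsub : (range (p ^ v)).filter
        (fun u => Nat.Coprime u p ∧ (p : ℤ) ^ v ∣ (u : ℤ) * (p : ℤ) ^ (k + 1) - b) ⊆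
      (range (p ^ v)).filter
        (fun u : ℕ => ((p ^ v : ℕ) : ℤ) ∣ (u : ℤ) * (p ^ (k + 1) : ℕ) - b) := by
    intro u hu
    rw [mem_filter] at hu ⊢
    exact ⟨hu.1, by exact_mod_cast hu.2.2⟩
  rw [← Finset.sum_subset hsub]
  · refine Finset.sum_congr rfl fun u hu => ?_
    obtain ⟨z, hz⟩ := (mem_filter.1 hu).2.2
    rw [mul_left_comm, Finset.mul_sum (a := (p : ℂ) ^ (k + 1))]
    congr 1
    refine Finset.sum_congr rfl fun ν _ => ?_
    rw [Nat.add_sub_cancel, ← sum_ramanujan_eq_repNum hp hm k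
      (fun r => q ν r - l r + h + ν * z) (fun r => hgood u ν r z hz) (fun r s hrs => by
        push_cast
        have h1 := hq_congr _ ν r s hrs
        have h2 := hl_congr _ r s hrs
        rw [h1, h2])]
    refine Finset.sum_congr rfl fun r _ => Finset.sum_congr rfl fun d _ => ?_
    have hz' : (u : ℚ) * (p : ℚ) ^ (k + 1) - b = p ^ v * z := by exact_mod_cast hz
    congr 3
    push_cast
    field_simp
    linear_combination (ν : ℚ) * hz'
  · intro u hu hnot
    rw [mem_filter] at hu
    have hcop : ¬ Nat.Coprime u (p ^ v) := fun hc => hnot (mem_filter.2 ⟨hu.1,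
      (Nat.coprime_pow_right_iff (Nat.pos_of_ne_zero hv0) _ _).1 hc, by exact_mod_cast hu.2⟩)
    rw [MulChar.map_nonunit χ (by rwa [ZMod.isUnit_iff_coprime]), map_zero, zero_mul]

end EisensteinWeil
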